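/- arXiv:1710.05314 — 2 statements merged into one kernel-verified Lean document; each statement's English description precedes it below -/
import Mathlib

section
/- Let 2^{[n]} be the lattice of subsets of {1,…,n} and define φ' on the edge set of the complete graph K_{n+1} on vertex set {0,1,…,n} by φ'({i,j}) = {i,j} ∖ {0}. Then (2^{[n]}, φ') is a lattice representation of the cycle matroid ℳ_n(1) of K_{n+1}: a set E of edges of K_{n+1} is a forest if and only if E admits an enumeration e_1,…,e_k with φ'(e_1) ⊊ φ'(e_1) ∪ φ'(e_2) ⊊ ⋯ ⊊ φ'(e_1) ∪ ⋯ ∪ φ'(e_k) strictly increasing. Moreover this representation is minimal: whenever (L', φ'') is a lattice representation of ℳ_n(1) and θ : 2^{[n]} → L' is a join-preserving map with θ ∘ φ' = φ'', then θ is a lattice isomorphism. -/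
/-- The join `φ(x₁) ⊔ ⋯ ⊔ φ(x_k)` of the images under `φ` of the elements of a list. -/
def psup {V : Type*} {L : Type*} [Lattice L] [OrderBot L] (φ : V → L) (l : List V) : L :=
  (l.map φ).foldr (· ⊔ ·) ⊥

/-- `(L, φ)` is a lattice representation of the simplicial complex `(V, H)`: `φ` maps
vertices to non-bottom elements of the lattice `L`, the image of `φ` join-generates `L`,
and `H` is exactly the set of subsets of `V` admitting an enumeration `x₁, …, x_k` such
that `φ(x₁) < φ(x₁) ⊔ φ(x₂) < ⋯ < φ(x₁) ⊔ ⋯ ⊔ φ(x_k)` is a strict chain in `L`. -/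
def IsLatticeRep {V : Type*} (H : Set (Set V)) (L : Type*) [Lattice L] [OrderBot L]
    (φ : V → L) : Prop :=
  (∀ v, φ v ≠ ⊥) ∧
  (∀ a : L, ∃ S : Finset V, a = S.sup φ) ∧
  ∀ S : Set V, S ∈ H ↔
    ∃ l : List V, l.Nodup ∧ {v | v ∈ l} = S ∧
      ∀ k, k + 2 ≤ l.length → psup φ (l.take (k + 1)) < psup φ (l.take (k + 2))

/-- The edge set of the complete graph `K_{n+1}` on vertex set `{0, 1, …, n} = Fin (n+1)`. -/
def KEdge (n : ℕ) := {e : Sym2 (Fin (n + 1)) // ¬ e.IsDiag}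

/-- The forests of `K_{n+1}`: the independent sets of the cycle matroid `ℳ_n(1)`. -/
def forests (n : ℕ) : Set (Set (KEdge n)) :=
  {E | (SimpleGraph.fromEdgeSet (Subtype.val '' E)).IsAcyclic}

/-- `φ'({i,j}) = {i,j} ∖ {0}`, a subset of the nonzero vertices `{1, …, n} ≃ Fin n`
(a nonzero vertex is `x.succ` for a unique `x : Fin n`). -/
def phiK (n : ℕ) (e : KEdge n) : Set (Fin n) := {x : Fin n | x.succ ∈ e.1}

section Psup

variable {V L : Type*} [Lattice L] [OrderBot L] {φ : V → L}

theorem psup_append_singleton (l : List V) (v : V) :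
    psup φ (l ++ [v]) = psup φ l ⊔ φ v := by
  induction l with
  | nil => simp [psup]
  | cons a l ih =>
    simp only [psup, List.cons_append, List.map_cons, List.foldr_cons] at ih ⊢
    rw [ih, sup_assoc]

theorem map_psup {M : Type*} [Lattice M] [OrderBot M] {θ : L → M}
    (hsup : ∀ a b, θ (a ⊔ b) = θ a ⊔ θ b) (hbot : θ ⊥ = ⊥) (l : List V) :
    θ (psup φ l) = psup (fun v => θ (φ v)) l := by
  induction l with
  | nil => simpa [psup] using hbot
  | cons a l ih =>
    simp only [psup, List.map_cons, List.foldr_cons] at ih ⊢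
    rw [hsup, ih]

/-- The partial joins of the images of the members of `l` form a strict chain. -/
def StrictPartialJoins (φ : V → L) (l : List V) : Prop :=
  ∀ k, k + 2 ≤ l.length → psup φ (l.take (k + 1)) < psup φ (l.take (k + 2))

theorem strictPartialJoins_append_singleton (hφ : ∀ v, φ v ≠ ⊥) (l : List V) (v : V) :
    StrictPartialJoins φ (l ++ [v]) ↔ StrictPartialJoins φ l ∧ ¬ φ v ≤ psup φ l := by
  rw [← left_lt_sup, ← psup_append_singleton]
  have hlen : (l ++ [v]).length = l.length + 1 := by simp
  constructor
  · intro h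
    constructor
    · intro k hk
      have := h k (by omega)
      rwa [List.take_append_of_le_length (by omega),
        List.take_append_of_le_length (by omega)] at this
    · rcases Nat.eq_zero_or_pos l.length with h0 | h0
      · obtain rfl := List.length_eq_zero_iff.mp h0
        simpa [psup, bot_lt_iff_ne_bot] using hφ v
      · have := h (l.length - 1) (by omega)
        rwa [List.take_append_of_le_length (by omega), List.take_of_length_le (by omega),
          List.take_of_length_le (by omega)] at this
  · rintro ⟨h, hv⟩ k hk
    rw [List.take_append_of_le_length (by omega)]
    rcases Nat.lt_or_ge l.length (k + 2) with h' | h'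
    · rwa [List.take_of_length_le (by omega), List.take_of_length_le (by omega)]
    · rw [List.take_append_of_le_length (by omega)]
      exact h k h'

end Psup

instance (n : ℕ) : Finite (KEdge n) := Subtype.finite

theorem mem_psup_phiK {n : ℕ} {l : List (KEdge n)} {x : Fin n} :
    x ∈ psup (phiK n) l ↔ ∃ e ∈ l, x ∈ phiK n e := by
  induction l with
  | nil => simp [psup]
  | cons a l ih =>
    change x ∈ phiK n a ∪ psup (phiK n) l ↔ _
    simp [ih]

theorem phiK_ne_bot {n : ℕ} (e : KEdge n) : phiK n e ≠ ⊥ := by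
  obtain ⟨e, he⟩ := e
  induction e with
  | h a b =>
    rw [Sym2.mk_isDiag_iff] at he
    refine Set.Nonempty.ne_empty ?_
    rcases Fin.eq_zero_or_eq_succ a with rfl | ⟨x, rfl⟩
    · rcases Fin.eq_zero_or_eq_succ b with rfl | ⟨x, rfl⟩
      · exact absurd rfl he
      · exact ⟨x, by simp [phiK]⟩
    · exact ⟨x, by simp [phiK]⟩

/-- The edge joining `0` to the nonzero vertex `x`. -/
def rootEdge {n : ℕ} (x : Fin n) : KEdge n :=
  ⟨s(0, x.succ), by simpa using (Fin.succ_ne_zero x).symm⟩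

theorem phiK_rootEdge {n : ℕ} (x : Fin n) : phiK n (rootEdge x) = {x} := by
  ext y
  simp [phiK, rootEdge]

theorem exists_eq_sup_phiK {n : ℕ} (a : Set (Fin n)) :
    ∃ S : Finset (KEdge n), a = S.sup (phiK n) := by
  classical
  refine ⟨a.toFinset.image rootEdge, ?_⟩
  rw [Finset.sup_image]
  apply le_antisymm
  · intro x hx
    have : (phiK n ∘ rootEdge) x ≤ a.toFinset.sup (phiK n ∘ rootEdge) :=
      Finset.le_sup (by simpa using hx)
    exact this (by simp [phiK_rootEdge])
  · refine Finset.sup_le fun x hx => ?_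
    simpa [phiK_rootEdge] using hx

theorem insert_mem_forests {n : ℕ} {E : Set (KEdge n)} {e : KEdge n} {x : Fin n}
    (hE : E ∈ forests n) (hx : x ∈ phiK n e) (hxE : ∀ e' ∈ E, x ∉ phiK n e') :
    insert e E ∈ forests n := by
  obtain ⟨e, he⟩ := e
  obtain ⟨w, rfl⟩ : ∃ w, e = s(x.succ, w) := Sym2.mem_iff_exists.mp hx
  have hw : x.succ ≠ w := by simpa using he
  have hreach : ¬ (SimpleGraph.fromEdgeSet (Subtype.val '' E)).Reachable x.succ w := by
    refine SimpleGraph.not_reachable_of_neighborSet_left_eq_empty hw ?_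
    ext u
    simp only [SimpleGraph.mem_neighborSet, SimpleGraph.fromEdgeSet_adj, Set.mem_empty_iff_false,
      iff_false]
    rintro ⟨⟨e', he', h⟩, -⟩
    exact hxE e' he' (by simp [phiK, h])
  have := hE.sup_edge_of_not_reachable hreach
  rw [SimpleGraph.edge, ← SimpleGraph.fromEdgeSet_union, Set.union_singleton] at this
  exact (congrArg (fun s => (SimpleGraph.fromEdgeSet s).IsAcyclic) Set.image_insert_eq).mpr this

theorem empty_mem_forests (n : ℕ) : ∅ ∈ forests n := by
  change (SimpleGraph.fromEdgeSet (Subtype.val '' ∅)).IsAcyclic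
  simp [SimpleGraph.isAcyclic_bot]

theorem forests_anti {n : ℕ} {E F : Set (KEdge n)} (h : E ⊆ F) (hF : F ∈ forests n) :
    E ∈ forests n :=
  SimpleGraph.IsAcyclic.anti (SimpleGraph.fromEdgeSet_mono (Set.image_mono h)) hF

/-- A finite acyclic graph with an edge has a vertex of degree one avoiding a given vertex. -/
theorem SimpleGraph.IsAcyclic.exists_ne_existsUnique_adj {V : Type*} [Finite V]
    {G : SimpleGraph V} (hG : G.IsAcyclic) {a b : V} (hab : G.Adj a b) (r : V) :
    ∃ v ≠ r, ∃! w, G.Adj v w := by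
  have : Nonempty V := ⟨a⟩
  have ⟨u, v, p, hp, hmax⟩ := Walk.exists_isPath_forall_isPath_length_le_length G
  have hlen : 1 ≤ p.length := hmax a b _ (Path.singleton hab).isPath
  have hnil : ¬p.Nil := by
    rw [← Walk.length_eq_zero_iff]; omega
  have hu : ∃! w, G.Adj u w := by
    refine ⟨_, p.adj_snd hnil, fun w hadj => hG.eq_snd_of_adj_start hp hadj ?_⟩
    have : ¬(p.cons hadj.symm).IsPath := by grind [Walk.length_cons]
    grind [hp.cons]
  have hv : ∃! w, G.Adj v w := by
    refine ⟨_, (p.adj_penultimate hnil).symm, fun w hadj =>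
      hG.eq_penultimate_of_adj_end hp hadj ?_⟩
    have : ¬(p.concat hadj).IsPath := by grind [Walk.length_concat]
    grind [hp.concat]
  by_cases h : u = r
  · exact ⟨v, fun hvr => hnil (hp.nil_iff_eq.mpr (h.trans hvr.symm)), hv⟩
  · exact ⟨u, h, hu⟩

theorem exists_pendant {n : ℕ} {E : Set (KEdge n)} (hE : E ∈ forests n) (hne : E.Nonempty) :
    ∃ e ∈ E, ∃ x ∈ phiK n e, ∀ e' ∈ E, x ∈ phiK n e' → e' = e := by
  have adj_of_mem : ∀ e ∈ E, ∀ a b, e.1 = s(a, b) →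
      (SimpleGraph.fromEdgeSet (Subtype.val '' E)).Adj a b := by
    intro e he a b hab
    refine (SimpleGraph.fromEdgeSet_adj _).mpr ⟨⟨e, he, hab⟩, fun h => e.2 ?_⟩
    rw [hab, h]
    exact rfl
  obtain ⟨e, he⟩ := hne
  obtain ⟨a, b, hab⟩ : ∃ a b, e.1 = s(a, b) := Sym2.exists.mp ⟨e.1, rfl⟩
  obtain ⟨v, hv, w, hw, huniq⟩ := hE.exists_ne_existsUnique_adj (adj_of_mem e he a b hab) 0
  obtain ⟨x, rfl⟩ := Fin.exists_succ_eq.mpr hv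
  obtain ⟨⟨f, hf, hfw⟩, -⟩ := (SimpleGraph.fromEdgeSet_adj _).mp hw
  refine ⟨f, hf, x, by simp [phiK, hfw], fun e' he' hx => Subtype.ext ?_⟩
  obtain ⟨u, hu⟩ : ∃ u, e'.1 = s(x.succ, u) := Sym2.mem_iff_exists.mp hx
  rw [hu, hfw, huniq u (adj_of_mem e' he' _ _ hu)]

theorem mem_forests_of_strictPartialJoins {n : ℕ} (l : List (KEdge n))
    (hl : StrictPartialJoins (phiK n) l) : {e | e ∈ l} ∈ forests n := by
  induction l using List.reverseRecOn with
  | nil => simpa using empty_mem_forests n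
  | append_singleton l e ih =>
    rw [strictPartialJoins_append_singleton phiK_ne_bot] at hl
    obtain ⟨x, hx, hxl⟩ := Set.not_subset.mp hl.2
    have hset : {e' | e' ∈ l ++ [e]} = insert e {e' | e' ∈ l} := by
      ext; simp [or_comm]
    rw [hset]
    exact insert_mem_forests (ih hl.1) hx fun e' he' h => hxl (mem_psup_phiK.mpr ⟨e', he', h⟩)

theorem exists_strictPartialJoins_of_mem_forests {n : ℕ} (E : Set (KEdge n))
    (hE : E ∈ forests n) :
    ∃ l : List (KEdge n), l.Nodup ∧ {e | e ∈ l} = E ∧ StrictPartialJoins (phiK n) l := by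
  induction h : E.ncard generalizing E with
  | zero =>
    obtain rfl := (Set.ncard_eq_zero E.toFinite).mp h
    exact ⟨[], by simp, by simp, fun k hk => by simp at hk⟩
  | succ k ih =>
    obtain ⟨e, he, x, hx, huniq⟩ := exists_pendant hE (Set.nonempty_of_ncard_ne_zero (by omega))
    obtain ⟨l, hnodup, hl, hchain⟩ := ih (E \ {e}) (forests_anti Set.sdiff_subset hE)
      (by rw [Set.ncard_sdiff_singleton_of_mem he, h]; rfl)
    have hmem : ∀ e', e' ∈ l ↔ e' ∈ E ∧ e' ≠ e := fun e' => Set.ext_iff.mp hl e'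
    refine ⟨l ++ [e], ?_, ?_, ?_⟩
    · refine hnodup.append (List.nodup_singleton e) ?_
      simp [hmem]
    · ext e'
      by_cases h' : e' = e <;> simp [hmem, h', he]
    · refine (strictPartialJoins_append_singleton phiK_ne_bot l e).mpr ⟨hchain, fun hle => ?_⟩
      obtain ⟨e', he', hx'⟩ := mem_psup_phiK.mp (hle hx)
      exact ((hmem e').mp he').2 (huniq e' ((hmem e').mp he').1 hx')

theorem isLatticeRep_phiK (n : ℕ) : IsLatticeRep (forests n) (Set (Fin n)) (phiK n) := by
  refine ⟨phiK_ne_bot, exists_eq_sup_phiK, fun E =>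
    ⟨exists_strictPartialJoins_of_mem_forests E, ?_⟩⟩
  rintro ⟨l, -, rfl, hl⟩
  exact mem_forests_of_strictPartialJoins l hl

/-- The `i`-th edge of the path visiting the vertices in the order given by `σ`. -/
def pathEdge {n : ℕ} (σ : Equiv.Perm (Fin (n + 1))) (i : Fin n) : KEdge n :=
  ⟨s(σ i.castSucc, σ i.succ), by simp [Fin.castSucc_lt_succ.ne]⟩

theorem range_pathEdge_mem_forests {n : ℕ} {σ : Equiv.Perm (Fin (n + 1))} (hσ : σ 0 = 0) :
    Set.range (pathEdge σ) ∈ forests n := by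
  have key : ∀ k, pathEdge σ '' {i | i.val < k} ∈ forests n := by
    intro k
    induction k with
    | zero => simpa using empty_mem_forests n
    | succ k ih =>
      by_cases hk : k < n
      · have hset : {i : Fin n | i.val < k + 1} = insert ⟨k, hk⟩ {i | i.val < k} := by
          ext i; simp [Fin.ext_iff]; omega
        have hne : σ (Fin.succ ⟨k, hk⟩) ≠ 0 := by
          rw [← hσ]; exact fun h => Fin.succ_ne_zero _ (σ.injective h)
        obtain ⟨x, hx⟩ := Fin.exists_succ_eq.mpr hne
        rw [hset, Set.image_insert_eq]
        refine insert_mem_forests (x := x) ih (by simp [phiK, pathEdge, hx]) ?_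
        rintro _ ⟨i, hi, rfl⟩ h
        simp only [phiK, pathEdge, hx, Set.mem_ofPred_eq, Sym2.mem_iff,
          EmbeddingLike.apply_eq_iff_eq] at h hi
        simp only [Fin.ext_iff, Fin.val_succ, Fin.val_castSucc] at h
        omega
      · refine forests_anti (Set.image_mono fun i _ => ?_) ih
        simp only [Set.mem_ofPred_eq]; omega
  exact forests_anti (by rintro _ ⟨i, rfl⟩; exact ⟨i, i.2, rfl⟩) (key n)

theorem not_map_univ_le_map_compl_singleton {n : ℕ} {L : Type*} [Lattice L] [OrderBot L]
    {φ : KEdge n → L} {θ : Set (Fin n) → L} (hφ : IsLatticeRep (forests n) L φ)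
    (hsup : ∀ a b, θ (a ⊔ b) = θ a ⊔ θ b) (hbot : θ ⊥ = ⊥) (hθ : ∀ e, θ (phiK n e) = φ e)
    (x : Fin n) : ¬ θ Set.univ ≤ θ {x}ᶜ := by
  intro hle
  have hmono : Monotone θ := fun a b hab => by
    rw [← sup_eq_right.mpr hab, hsup]; exact le_sup_left
  set σ : Equiv.Perm (Fin (n + 1)) := Equiv.swap (Fin.last n) x.succ
  have hpos : 0 < n := x.pos
  have hσ0 : σ 0 = 0 :=
    Equiv.swap_apply_of_ne_of_ne (by simp [Fin.ext_iff]; omega) (Fin.succ_ne_zero x).symm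
  have hσlast : σ (Fin.last n) = x.succ := Equiv.swap_apply_left _ _
  obtain ⟨l, -, hl, hchain⟩ := (hφ.2.2 _).mp (range_pathEdge_mem_forests hσ0)
  change StrictPartialJoins φ l at hchain
  have hmem : ∀ i, pathEdge σ i ∈ l := fun i => by
    have : pathEdge σ i ∈ {e | e ∈ l} := hl ▸ Set.mem_range_self i
    exact this
  rcases List.eq_nil_or_concat' l with rfl | ⟨m, e, rfl⟩
  · simpa using hmem ⟨0, hpos⟩
  rw [strictPartialJoins_append_singleton hφ.1] at hchain
  have hpsup : psup φ m = θ (psup (phiK n) m) := by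
    rw [map_psup hsup hbot]; simp only [hθ]
  apply hchain.2
  rw [← hθ, hpsup]
  refine (hmono (Set.subset_univ _)).trans (hle.trans (hmono fun y hy => ?_))
  rw [mem_psup_phiK]
  obtain ⟨j, hj⟩ : ∃ j, σ j = y.succ := σ.surjective _
  obtain ⟨i, rfl⟩ : ∃ i : Fin n, i.succ = j := by
    refine Fin.exists_succ_eq.mpr ?_
    rintro rfl
    exact Fin.succ_ne_zero y (hj.symm.trans hσ0)
  have hi : i.val + 1 < n := by
    by_contra h
    have : i.succ = Fin.last n := by ext; simp; omega
    rw [this, hσlast] at hj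
    exact hy (Fin.succ_injective _ hj).symm
  have hcast : (Fin.castSucc ⟨i.val + 1, hi⟩ : Fin (n + 1)) = i.succ := rfl
  by_cases he : pathEdge σ i = e
  · refine ⟨pathEdge σ ⟨i.val + 1, hi⟩, ?_, by simp [phiK, pathEdge, hcast, hj, -Fin.castSucc_mk]⟩
    have hne : pathEdge σ ⟨i.val + 1, hi⟩ ≠ e := by
      rw [← he]
      intro h
      have := congrArg Subtype.val h
      simp only [pathEdge, Sym2.eq_iff, EmbeddingLike.apply_eq_iff_eq, Fin.ext_iff, Fin.val_succ,
        Fin.val_castSucc] at this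
      omega
    simpa [hne] using hmem ⟨i.val + 1, hi⟩
  · exact ⟨pathEdge σ i, by simpa [he] using hmem i, by simp [phiK, pathEdge, hj]⟩

/-- `(2^{[n]}, φ')` with `φ'({i,j}) = {i,j} ∖ {0}` is a lattice
representation of the cycle matroid `ℳ_n(1)` of `K_{n+1}`: the forests of `K_{n+1}` are
exactly the edge sets admitting an enumeration whose successive unions of `φ'`-images form
a strictly increasing chain. Moreover this representation is minimal: any join-preserving
map `θ` from `2^{[n]}` to another lattice representation `(L', φ'')` commuting with the
vertex maps is a lattice isomorphism. -/
theorem cycle_matroid_minimal_rep (n : ℕ) :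
    IsLatticeRep (forests n) (Set (Fin n)) (phiK n) ∧
    ∀ (L' : Type) [Lattice L'] [OrderBot L'] [Finite L'] (φ'' : KEdge n → L')
      (θ : Set (Fin n) → L'),
      IsLatticeRep (forests n) L' φ'' →
      (∀ a b : Set (Fin n), θ (a ⊔ b) = θ a ⊔ θ b) → θ ⊥ = ⊥ →
      (∀ e : KEdge n, θ (phiK n e) = φ'' e) →
      Function.Bijective θ ∧ ∀ a b : Set (Fin n), a ≤ b ↔ θ a ≤ θ b := by
  refine ⟨isLatticeRep_phiK n, fun L' _ _ _ φ'' θ hφ hsup hbot hθ => ?_⟩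
  have hmono : Monotone θ := fun a b hab => by
    rw [← sup_eq_right.mpr hab, hsup]; exact le_sup_left
  have hreflect : ∀ a b, θ a ≤ θ b → a ≤ b := by
    intro a b hab x hxa
    by_contra hxb
    refine not_map_univ_le_map_compl_singleton hφ hsup hbot hθ x ?_
    have hb : b ≤ {x}ᶜ := by rintro y hy rfl; exact hxb hy
    have huniv : (Set.univ : Set (Fin n)) ≤ a ⊔ {x}ᶜ := by
      intro y _
      by_cases hy : y = x
      · exact Or.inl (hy ▸ hxa)
      · exact Or.inr hy
    exact (hmono huniv).trans <| (hsup _ _).trans_le <| sup_le (hab.trans (hmono hb)) le_rfl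
  refine ⟨⟨fun a b h => le_antisymm (hreflect a b h.le) (hreflect b a h.ge), fun c => ?_⟩,
    fun a b => ⟨fun h => hmono h, hreflect a b⟩⟩
  obtain ⟨S, rfl⟩ := hφ.2.1 c
  refine ⟨S.sup (phiK n), ?_⟩
  rw [Finset.apply_sup_eq_sup_comp θ hsup hbot]
  exact Finset.sup_congr rfl fun e _ => hθ e
end

section
/- Let ℋ = (V,H) be a finite simplicial complex admitting a lattice representation (L,φ), and suppose L has exactly p meet irreducible elements. Then ℋ has a Boolean matrix representation with p rows (hence mindeg(ℋ) ≤ p); explicitly, the matrix M with rows indexed by the meet irreducible elements i of L and columns indexed by V, with entry 0 in position (i,v) if φ(v) ≤ i and entry 1 otherwise, is a Boolean matrix representation of ℋ. -/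
/-- `M` is a Boolean matrix representation of the simplicial complex `(V, H)`: for every
`W ⊆ V`, `W ∈ H` iff `M` has a square submatrix with column set `W` which, after
independently permuting rows and columns, is lower unitriangular (diagonal entries `1`,
entries above the diagonal `0`). -/
def IsBoolRep {R V : Type*} (H : Set (Set V)) (M : R → V → Bool) : Prop :=
  ∀ W : Set V, W ∈ H ↔
    ∃ (k : ℕ) (r : Fin k → R) (c : Fin k → V),
      Function.Injective r ∧ Function.Injective c ∧ Set.range c = W ∧
      (∀ i : Fin k, M (r i) (c i) = true) ∧
      ∀ i j : Fin k, i < j → M (r i) (c j) = false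

section ListJoin

variable {V L : Type*} [Lattice L] [OrderBot L]

theorem psup_le_iff (φ : V → L) (l : List V) (b : L) :
    psup φ l ≤ b ↔ ∀ v ∈ l, φ v ≤ b := by
  induction l with
  | nil => simp [psup]
  | cons a t ih =>
    have h : psup φ (a :: t) = φ a ⊔ psup φ t := rfl
    simp [h, ih]

theorem psup_take_succ (φ : V → L) (l : List V) (n : ℕ) (hn : n < l.length) :
    psup φ (l.take (n + 1)) = psup φ (l.take n) ⊔ φ l[n] := by
  refine eq_of_forall_ge_iff fun b => ?_
  rw [sup_le_iff, psup_le_iff, psup_le_iff, List.take_add_one, List.getElem?_eq_getElem hn]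
  simp only [Option.toList_some, List.mem_append, List.mem_singleton, or_imp, forall_and,
    forall_eq]

theorem psup_take_strict_iff (φ : V → L) (hφ : ∀ v, φ v ≠ ⊥) (l : List V) :
    (∀ k, k + 2 ≤ l.length → psup φ (l.take (k + 1)) < psup φ (l.take (k + 2))) ↔
      ∀ n (hn : n < l.length), ¬ φ l[n] ≤ psup φ (l.take n) := by
  constructor
  · rintro h (_ | n) hn
    · simpa [psup] using hφ _
    · have := h n hn
      rwa [psup_take_succ φ l (n + 1) hn, left_lt_sup] at this
  · intro h k hk
    rw [psup_take_succ φ l (k + 1) hk, left_lt_sup]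
    exact h _ _

end ListJoin

theorem exists_infIrred_ge_of_not_le {L : Type*} [Lattice L] [Finite L] {a b : L}
    (h : ¬ a ≤ b) : ∃ i, InfIrred i ∧ b ≤ i ∧ ¬ a ≤ i := by
  obtain ⟨m, hbm, hm⟩ := Finite.exists_le_maximal (p := fun x => ¬ a ≤ x) h
  have key : ∀ x, m ≤ x → x ≠ m → a ≤ x := fun x hx hne => by
    by_contra hax
    exact hne (le_antisymm (hm.2 hax hx) hx)
  refine ⟨m, ⟨fun hmax => hm.1 (le_sup_right.trans (hmax (le_sup_left : m ≤ m ⊔ a))), ?_⟩,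
    hbm, hm.1⟩
  intro x y hxy
  by_contra! hne
  exact hm.1 (hxy ▸ le_inf (key x (hxy ▸ inf_le_left) hne.1) (key y (hxy ▸ inf_le_right) hne.2))

theorem IsBoolRep.comp_equiv {R R' V : Type*} {H : Set (Set V)} {M : R → V → Bool}
    (h : IsBoolRep H M) (e : R' ≃ R) : IsBoolRep H (fun i => M (e i)) := by
  intro W
  rw [h W]
  constructor
  · rintro ⟨k, r, c, hr, hc, hW, h1, h2⟩
    exact ⟨k, e.symm ∘ r, c, e.symm.injective.comp hr, hc, hW, by simpa using h1,
      by simpa using h2⟩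
  · rintro ⟨k, r, c, hr, hc, hW, h1, h2⟩
    exact ⟨k, e ∘ r, c, e.injective.comp hr, hc, hW, h1, h2⟩

open Classical in
theorem IsLatticeRep.isBoolRep_infIrred {V L : Type*} {H : Set (Set V)} [Lattice L] [OrderBot L]
    [Finite L] {φ : V → L} (hrep : IsLatticeRep H L φ) :
    IsBoolRep H (fun (i : {a : L // InfIrred a}) (v : V) =>
      if φ v ≤ i.1 then false else true) := by
  obtain ⟨hφ, -, hH⟩ := hrep
  intro W
  simp only [hH, psup_take_strict_iff φ hφ]
  constructor
  · rintro ⟨l, hnd, hW, hl⟩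
    choose r hirr hle hnle using fun n : Fin l.length =>
      exists_infIrred_ge_of_not_le (hl n n.2)
    have hlt : ∀ i j : Fin l.length, i < j → φ (l.get j.rev) ≤ r i.rev := fun i j hij =>
      (psup_le_iff φ _ _).1 (hle i.rev) _ <|
        List.mem_take_iff_getElem.2 ⟨j.rev, by simp; omega, rfl⟩
    refine ⟨l.length, fun i => ⟨r i.rev, hirr _⟩, fun i => l.get i.rev, ?_,
      (List.nodup_iff_injective_get.1 hnd).comp Fin.rev_injective, ?_, ?_, ?_⟩
    · refine Function.Injective.of_lt_imp_ne fun i j hij heq => hnle j.rev ?_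
      exact (hlt i j hij).trans_eq (congrArg Subtype.val heq)
    · rw [← hW, ← Set.range_list_get]
      exact Fin.rev_surjective.range_comp l.get
    · intro i
      simpa using hnle i.rev
    · intro i j hij
      simpa using hlt i j hij
  · rintro ⟨k, r, c, -, hc, hW, hdiag, hlt⟩
    refine ⟨List.ofFn (fun i => c i.rev), List.nodup_ofFn.2 (hc.comp Fin.rev_injective), ?_, ?_⟩
    · rw [← hW]
      ext v
      simp only [Set.mem_ofPred_eq, List.mem_ofFn]
      exact Set.ext_iff.1 (Fin.rev_surjective.range_comp c) v
    · intro n hn hle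
      have hnk : n < k := by simpa using hn
      have hd := hdiag (Fin.rev ⟨n, hnk⟩)
      simp only [Bool.if_false_left, Bool.and_true, Bool.not_eq_true', decide_eq_false_iff_not]
        at hd
      rw [List.getElem_ofFn] at hle
      refine hd (hle.trans ((psup_le_iff φ _ _).2 fun v hv => ?_))
      obtain ⟨m, hm, rfl⟩ := List.mem_take_iff_getElem.1 hv
      rw [List.getElem_ofFn]
      rw [lt_min_iff] at hm
      have hmk : m < k := hm.1.trans hnk
      simpa using hlt (Fin.rev ⟨n, hnk⟩) (Fin.rev ⟨m, hmk⟩) (Fin.rev_lt_rev.2 hm.1)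

open Classical in
/-- If a finite simplicial complex `(V, H)` has a lattice representation
`(L, φ)` and `L` has exactly `p` meet irreducible elements, then the Boolean matrix whose
rows are indexed by the meet irreducible elements `i` of `L`, with `(i, v)`-entry `0` iff
`φ(v) ≤ i`, is a Boolean matrix representation of `(V, H)`; hence `(V, H)` has a Boolean
matrix representation with `p` rows, i.e. `mindeg ≤ p`. -/
theorem boolRep_of_latticeRep (V : Type*) [Finite V] (H : Set (Set V))
    (L : Type*) [Lattice L] [OrderBot L] [Finite L] (φ : V → L)
    (hrep : IsLatticeRep H L φ) (p : ℕ) (hp : Nat.card {a : L // InfIrred a} = p) :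
    IsBoolRep H (fun (i : {a : L // InfIrred a}) (v : V) =>
      if φ v ≤ i.1 then false else true) ∧
    ∃ M : Fin p → V → Bool, IsBoolRep H M := by
  have h := hrep.isBoolRep_infIrred
  exact ⟨h, _, h.comp_equiv (Finite.equivFinOfCardEq hp).symm⟩
end
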